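/- Let A ∈ C* and define the 3×3 matrices G₁ = diag(A^{-4}, -1, -1), G₂ = [[-A/(1+A^{-4}), -A^{-2}, 0], [-(1-A^{12})(1-A⁴)³/A^{34}, 1/(1+A⁸), 0], [0, 0, -1]], G₃ = [[-1, 0, 0], [0, -1/(1+A^{-4}+A^{-8}), -A^{-2}], [0, -(1+A⁸)²(A⁴-1)²(A^{12}-1)²/A^{66}, A^{-12}/(1+A^{-4}+A^{-8})]] (assume all denominators nonzero and A a primitive 20-th root of unity). Then no nonzero vector w ∈ C³ satisfies G_i w = -w for all i = 1,2,3; consequently the representation of B₄ generated by G₁,G₂,G₃ has no 1-dimensional invariant subspace on which all G_i act by -1. -/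

import Mathlib

/-- The matrix of `(-A⁻¹)ρ(g₁)` on `V(4,2)`. -/
noncomputable def H₁ (A : ℂ) : Matrix (Fin 3) (Fin 3) ℂ :=
  !![A ^ (-4 : ℤ), 0, 0; 0, -1, 0; 0, 0, -1]

/-- The matrix of `(-A⁻¹)ρ(g₂)` on `V(4,2)`. -/
noncomputable def H₂ (A : ℂ) : Matrix (Fin 3) (Fin 3) ℂ :=
  !![-A / (1 + A ^ (-4 : ℤ)), -A ^ (-2 : ℤ), 0;
     -(1 - A ^ 12) * (1 - A ^ 4) ^ 3 / A ^ 34, 1 / (1 + A ^ 8), 0;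
     0, 0, -1]

/-- The matrix of `(-A⁻¹)ρ(g₃)` on `V(4,2)`. -/
noncomputable def H₃ (A : ℂ) : Matrix (Fin 3) (Fin 3) ℂ :=
  !![-1, 0, 0;
     0, -1 / (1 + A ^ (-4 : ℤ) + A ^ (-8 : ℤ)), -A ^ (-2 : ℤ);
     0, -(1 + A ^ 8) ^ 2 * (A ^ 4 - 1) ^ 2 * (A ^ 12 - 1) ^ 2 / A ^ 66,
        A ^ (-12 : ℤ) / (1 + A ^ (-4 : ℤ) + A ^ (-8 : ℤ))]

/-- for `A` a primitive 20-th root of unity (denominators nonzero),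
no nonzero vector `w ∈ ℂ³` satisfies `Hᵢ w = -w` for all `i`; i.e. there is no
1-dimensional invariant subspace on which all generators act by `-1`. -/
theorem no_common_neg_one_eigenvector (A : ℂ) (hA : IsPrimitiveRoot A 20)
    (h1 : 1 + A ^ (-4 : ℤ) ≠ 0) (h2 : 1 + A ^ 8 ≠ 0)
    (h3 : 1 + A ^ (-4 : ℤ) + A ^ (-8 : ℤ) ≠ 0) :
    ∀ w : Fin 3 → ℂ,
      (H₁ A).mulVec w = -w → (H₂ A).mulVec w = -w → (H₃ A).mulVec w = -w → w = 0 := by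
  intro w hw₁ hw₂ hw₃
  have hA₀ : A ^ (-2 : ℤ) ≠ 0 := zpow_ne_zero _ (hA.ne_zero (by norm_num))
  have hx : w 0 = 0 := by
    have h : A ^ (-4 : ℤ) * w 0 = -w 0 := by
      simpa [H₁, Matrix.mulVec, dotProduct, Fin.sum_univ_three, -zpow_neg] using congrFun hw₁ 0
    exact (mul_eq_zero.mp (by linear_combination h : (1 + A ^ (-4 : ℤ)) * w 0 = 0)).resolve_left h1
  have hy : w 1 = 0 := by
    have h : A ^ (-2 : ℤ) = 0 ∨ w 1 = 0 := by
      simpa [H₂, Matrix.mulVec, dotProduct, Fin.sum_univ_three, hx, -zpow_neg]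
        using congrFun hw₂ 0
    exact h.resolve_left hA₀
  have hz : w 2 = 0 := by
    have h : A ^ (-2 : ℤ) = 0 ∨ w 2 = 0 := by
      simpa [H₃, Matrix.mulVec, dotProduct, Fin.sum_univ_three, hy, -zpow_neg]
        using congrFun hw₃ 1
    exact h.resolve_left hA₀
  ext i
  fin_cases i
  exacts [hx, hy, hz]
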